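/- arXiv:0805.0339 — 3 statements merged into one kernel-verified Lean document; each statement's English description precedes it below -/
import Mathlib

section
/- Let N and N′ be two k-mosaics that are each internally suitably connected (for every two adjacent cells within the k×k block, the facing edges agree on whether they carry a connection point) and that have identical connection-point patterns on the boundary of the k×k block (for every cell of the block and every edge of that cell lying on the boundary of the block, the tile of N has a connection point on that edge iff the tile of N′ does). Then for every location (i,j), the k-move N ↔^(i,j) N′ maps knot n-mosaics to knot n-mosaics; in particular it restricts to a permutation of the set of knot n-mosaics. -/
/-- An `n`-mosaic: an `n × n` matrix of tiles, the tiles being indexed by `Fin 11`. -/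
def Mosaic (n : ℕ) : Type := Fin n → Fin n → Fin 11

instance {n : ℕ} : DecidableEq (Mosaic n) := by unfold Mosaic; infer_instance

/-- The four edges of a tile. -/
inductive MEdge : Type
  | top
  | bottom
  | left
  | right
  deriving DecidableEq

/-- The connection points of each of the 11 tiles: `cp t e` holds iff tile `t`
has a connection point on edge `e`. -/
def cp : Fin 11 → MEdge → Prop
  | ⟨0, _⟩, _ => False
  | ⟨1, _⟩, e => e = MEdge.left ∨ e = MEdge.bottom
  | ⟨2, _⟩, e => e = MEdge.right ∨ e = MEdge.bottom
  | ⟨3, _⟩, e => e = MEdge.top ∨ e = MEdge.right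
  | ⟨4, _⟩, e => e = MEdge.top ∨ e = MEdge.left
  | ⟨5, _⟩, e => e = MEdge.left ∨ e = MEdge.right
  | ⟨6, _⟩, e => e = MEdge.top ∨ e = MEdge.bottom
  | _, _ => True

/-- A knot `n`-mosaic: every tile is suitably connected, i.e. facing edges of adjacent
tiles agree on carrying a connection point, and no connection point lies on the outer
boundary of the mosaic.  Rows are indexed top-to-bottom, columns left-to-right. -/
def IsKnotMosaic {n : ℕ} (M : Mosaic n) : Prop :=
  (∀ (a b : Fin n) (h : b.val + 1 < n),
      (cp (M a b) MEdge.right ↔ cp (M a ⟨b.val + 1, h⟩) MEdge.left)) ∧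
  (∀ (a b : Fin n) (h : a.val + 1 < n),
      (cp (M a b) MEdge.bottom ↔ cp (M ⟨a.val + 1, h⟩ b) MEdge.top)) ∧
  (∀ a b : Fin n,
      (a.val = 0 → ¬ cp (M a b) MEdge.top) ∧
      (a.val = n - 1 → ¬ cp (M a b) MEdge.bottom) ∧
      (b.val = 0 → ¬ cp (M a b) MEdge.left) ∧
      (b.val = n - 1 → ¬ cp (M a b) MEdge.right))

/-- A `k`-mosaic is internally suitably connected if within the `k × k` block every
pair of facing edges of adjacent tiles agree on carrying a connection point. -/
def InternallyConnected {k : ℕ} (N : Mosaic k) : Prop :=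
  (∀ (a b : Fin k) (h : b.val + 1 < k),
      (cp (N a b) MEdge.right ↔ cp (N a ⟨b.val + 1, h⟩) MEdge.left)) ∧
  (∀ (a b : Fin k) (h : a.val + 1 < k),
      (cp (N a b) MEdge.bottom ↔ cp (N ⟨a.val + 1, h⟩ b) MEdge.top))

/-- Two `k`-mosaics have identical connection-point patterns on the boundary of the
`k × k` block. -/
def BoundaryAgree {k : ℕ} (N N' : Mosaic k) : Prop :=
  ∀ a b : Fin k,
    (a.val = 0 → (cp (N a b) MEdge.top ↔ cp (N' a b) MEdge.top)) ∧
    (a.val = k - 1 → (cp (N a b) MEdge.bottom ↔ cp (N' a b) MEdge.bottom)) ∧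
    (b.val = 0 → (cp (N a b) MEdge.left ↔ cp (N' a b) MEdge.left)) ∧
    (b.val = k - 1 → (cp (N a b) MEdge.right ↔ cp (N' a b) MEdge.right))

/-- The `k`-submosaic of an `n`-mosaic `M` at location `(i, j)`. -/
def submosaic {n : ℕ} (k i j : ℕ) (hi : i + k ≤ n) (hj : j + k ≤ n)
    (M : Mosaic n) : Mosaic k :=
  fun a b =>
    M ⟨i + a.val, lt_of_lt_of_le (Nat.add_lt_add_left a.isLt i) hi⟩
      ⟨j + b.val, lt_of_lt_of_le (Nat.add_lt_add_left b.isLt j) hj⟩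

/-- Replace the `k`-submosaic of `M` at location `(i, j)` by the `k`-mosaic `N`. -/
def replaceSub {n : ℕ} (k i j : ℕ) (M : Mosaic n) (N : Mosaic k) : Mosaic n :=
  fun a b =>
    if h : i ≤ a.val ∧ a.val < i + k ∧ j ≤ b.val ∧ b.val < j + k then
      N ⟨a.val - i, by omega⟩ ⟨b.val - j, by omega⟩
    else M a b

/-- The `k`-move `N ↔^(i,j) N'` on the set of `n`-mosaics. -/
def kMove {n : ℕ} (k i j : ℕ) (hi : i + k ≤ n) (hj : j + k ≤ n)
    (N N' : Mosaic k) (M : Mosaic n) : Mosaic n :=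
  if submosaic k i j hi hj M = N then replaceSub k i j M N'
  else if submosaic k i j hi hj M = N' then replaceSub k i j M N
  else M

section

variable {n k i j : ℕ}

theorem submosaic_replaceSub (hi : i + k ≤ n) (hj : j + k ≤ n) (M : Mosaic n) (N : Mosaic k) :
    submosaic k i j hi hj (replaceSub k i j M N) = N := by
  funext a b
  simp [submosaic, replaceSub]

theorem replaceSub_replaceSub (M : Mosaic n) (N N' : Mosaic k) :
    replaceSub k i j (replaceSub k i j M N) N' = replaceSub k i j M N' := by
  funext a b
  simp only [replaceSub]
  split_ifs <;> rfl

theorem replaceSub_submosaic (hi : i + k ≤ n) (hj : j + k ≤ n) (M : Mosaic n) :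
    replaceSub k i j M (submosaic k i j hi hj M) = M := by
  funext a b
  simp only [replaceSub, submosaic]
  split_ifs with h
  · congr 1 <;> ext <;> dsimp only <;> omega
  · rfl

theorem kMove_involutive (hi : i + k ≤ n) (hj : j + k ≤ n) (N N' : Mosaic k) :
    Function.Involutive (kMove k i j hi hj N N') := by
  intro M
  have h := replaceSub_submosaic hi hj M
  by_cases h₁ : submosaic k i j hi hj M = N
  · rw [h₁] at h
    by_cases h₂ : N' = N
    · subst h₂
      simp [kMove, h₁, h]
    · simp [kMove, h₁, h₂, submosaic_replaceSub, replaceSub_replaceSub, h]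
  · by_cases h₂ : submosaic k i j hi hj M = N'
    · rw [h₂] at h h₁
      simp [kMove, h₁, h₂, submosaic_replaceSub, replaceSub_replaceSub, h]
    · simp [kMove, h₁, h₂]

theorem BoundaryAgree.symm {N N' : Mosaic k} (h : BoundaryAgree N N') : BoundaryAgree N' N :=
  fun a b => ⟨fun e => ((h a b).1 e).symm, fun e => ((h a b).2.1 e).symm,
    fun e => ((h a b).2.2.1 e).symm, fun e => ((h a b).2.2.2 e).symm⟩

/-- Replacing a block by one with the same boundary pattern changes no connection point on an
edge that is not interior to the block. -/
theorem cp_replaceSub_replaceSub {N N' : Mosaic k} (hbd : BoundaryAgree N N') (M : Mosaic n)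
    (a b : Fin n) :
    let block := i ≤ a.val ∧ a.val < i + k ∧ j ≤ b.val ∧ b.val < j + k
    let M₁ := replaceSub k i j M N
    let M₂ := replaceSub k i j M N'
    ((block → a.val = i) → (cp (M₁ a b) MEdge.top ↔ cp (M₂ a b) MEdge.top)) ∧
    ((block → a.val + 1 = i + k) → (cp (M₁ a b) MEdge.bottom ↔ cp (M₂ a b) MEdge.bottom)) ∧
    ((block → b.val = j) → (cp (M₁ a b) MEdge.left ↔ cp (M₂ a b) MEdge.left)) ∧
    ((block → b.val + 1 = j + k) → (cp (M₁ a b) MEdge.right ↔ cp (M₂ a b) MEdge.right)) := by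
  intro block M₁ M₂
  by_cases h : block
  · have e₁ : M₁ a b = N ⟨a.val - i, by omega⟩ ⟨b.val - j, by omega⟩ := dif_pos h
    have e₂ : M₂ a b = N' ⟨a.val - i, by omega⟩ ⟨b.val - j, by omega⟩ := dif_pos h
    obtain ⟨ht, hb, hl, hr⟩ := hbd ⟨a.val - i, by omega⟩ ⟨b.val - j, by omega⟩
    dsimp only at ht hb hl hr
    rw [e₁, e₂]
    refine ⟨fun q => ht ?_, fun q => hb ?_, fun q => hl ?_, fun q => hr ?_⟩ <;>
    · have := q h
      omega
  · have e₁ : M₁ a b = M a b := dif_neg h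
    have e₂ : M₂ a b = M a b := dif_neg h
    simp [e₁, e₂]

theorem IsKnotMosaic.replaceSub_of_boundaryAgree (hi : i + k ≤ n) (hj : j + k ≤ n)
    {N N' : Mosaic k} (hN' : InternallyConnected N') (hbd : BoundaryAgree N N') {M : Mosaic n}
    (hM : IsKnotMosaic M) (hs : submosaic k i j hi hj M = N) :
    IsKnotMosaic (replaceSub k i j M N') := by
  have hMN : replaceSub k i j M N = M := hs ▸ replaceSub_submosaic hi hj M
  have key := cp_replaceSub_replaceSub (i := i) (j := j) hbd M
  simp only [hMN] at key
  obtain ⟨hh, hv, ho⟩ := hM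
  refine ⟨fun a b h => ?_, fun a b h => ?_, fun a b => ?_⟩
  · by_cases hin : (i ≤ a.val ∧ a.val < i + k) ∧ j ≤ b.val ∧ b.val + 1 < j + k
    · have e₁ : replaceSub k i j M N' a b = N' ⟨a.val - i, by omega⟩ ⟨b.val - j, by omega⟩ :=
        dif_pos (by omega)
      have e₂ : replaceSub k i j M N' a ⟨b.val + 1, h⟩ =
          N' ⟨a.val - i, by omega⟩ ⟨b.val - j + 1, by omega⟩ := by
        refine (dif_pos (by dsimp only; omega)).trans ?_
        congr 2
        dsimp only
        omega
      rw [e₁, e₂]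
      exact hN'.1 _ ⟨b.val - j, by omega⟩ (by dsimp only; omega)
    · rw [← (key a b).2.2.2 (by omega), ← (key a ⟨b.val + 1, h⟩).2.2.1 (by dsimp only; omega)]
      exact hh a b h
  · by_cases hin : (i ≤ a.val ∧ a.val + 1 < i + k) ∧ j ≤ b.val ∧ b.val < j + k
    · have e₁ : replaceSub k i j M N' a b = N' ⟨a.val - i, by omega⟩ ⟨b.val - j, by omega⟩ :=
        dif_pos (by omega)
      have e₂ : replaceSub k i j M N' ⟨a.val + 1, h⟩ b =
          N' ⟨a.val - i + 1, by omega⟩ ⟨b.val - j, by omega⟩ := by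
        refine (dif_pos (by dsimp only; omega)).trans ?_
        congr 2
        dsimp only
        omega
      rw [e₁, e₂]
      exact hN'.2 ⟨a.val - i, by omega⟩ _ (by dsimp only; omega)
    · rw [← (key a b).2.1 (by omega), ← (key ⟨a.val + 1, h⟩ b).1 (by dsimp only; omega)]
      exact hv a b h
  · obtain ⟨ht, hb, hl, hr⟩ := ho a b
    obtain ⟨kt, kb, kl, kr⟩ := key a b
    exact ⟨fun q => (kt (by omega)).not.mp (ht q), fun q => (kb (by omega)).not.mp (hb q),
      fun q => (kl (by omega)).not.mp (hl q), fun q => (kr (by omega)).not.mp (hr q)⟩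

end

/-- If `N` and `N'` are internally suitably connected `k`-mosaics with identical
connection-point patterns on the boundary of the `k × k` block, then for every
location `(i, j)` the `k`-move `N ↔^(i,j) N'` maps knot `n`-mosaics to knot
`n`-mosaics; in particular it restricts to a permutation of the set of knot
`n`-mosaics. -/
theorem kMove_preserves_knot {n k i j : ℕ} (hi : i + k ≤ n) (hj : j + k ≤ n)
    (N N' : Mosaic k)
    (hN : InternallyConnected N) (hN' : InternallyConnected N')
    (hbd : BoundaryAgree N N') :
    (∀ M : Mosaic n, IsKnotMosaic M → IsKnotMosaic (kMove k i j hi hj N N' M)) ∧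
    Set.BijOn (kMove k i j hi hj N N')
      {M : Mosaic n | IsKnotMosaic M} {M : Mosaic n | IsKnotMosaic M} := by
  have hmap : ∀ M : Mosaic n, IsKnotMosaic M → IsKnotMosaic (kMove k i j hi hj N N' M) := by
    intro M hM
    unfold kMove
    split_ifs with h₁ h₂
    · exact hM.replaceSub_of_boundaryAgree hi hj hN' hbd h₁
    · exact hM.replaceSub_of_boundaryAgree hi hj hN hbd.symm h₂
    · exact hM
  have hinv := kMove_involutive hi hj N N'
  exact ⟨hmap, hmap, hinv.injective.injOn, fun M hM => ⟨_, hmap M hM, hinv M⟩⟩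
end

section
/- There are exactly two knot 2-mosaics: the set of 2-mosaics that are knot 2-mosaics has cardinality 2 (namely the all-blank mosaic and the mosaic with tiles T_2, T_1 in the top row and T_3, T_4 in the bottom row). Hence the Hilbert space of knot 2-mosaics has dimension D₂ = 2. -/
instance (t : Fin 11) (e : MEdge) : Decidable (cp t e) := by
  unfold cp
  split <;> infer_instance

theorem eq_blank_or_of_not_cp_top_left (t : Fin 11) (h : ¬ cp t .top) (h' : ¬ cp t .left) :
    t = 0 ∨ t = 2 := by
  decide +revert

theorem eq_blank_or_of_not_cp_top_right (t : Fin 11) (h : ¬ cp t .top) (h' : ¬ cp t .right) :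
    t = 0 ∨ t = 1 := by
  decide +revert

theorem eq_blank_or_of_not_cp_bottom_left (t : Fin 11) (h : ¬ cp t .bottom) (h' : ¬ cp t .left) :
    t = 0 ∨ t = 3 := by
  decide +revert

theorem eq_blank_or_of_not_cp_bottom_right (t : Fin 11) (h : ¬ cp t .bottom)
    (h' : ¬ cp t .right) : t = 0 ∨ t = 4 := by
  decide +revert

/-- The knot `2`-mosaics are the blank mosaic and the four-tile circle. -/
theorem isKnotMosaic_two_iff (M : Mosaic 2) :
    IsKnotMosaic M ↔ M = (fun _ _ => (0 : Fin 11)) ∨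
      M = (fun a b => if a = 0 then (if b = 0 then (2 : Fin 11) else 1)
                   else (if b = 0 then 3 else 4)) := by
  constructor
  · rintro ⟨hr, hc, hb⟩
    have h₁ := hr 0 0 (by decide)
    have h₂ := hr 1 0 (by decide)
    have h₃ := hc 0 0 (by decide)
    have h₄ := hc 0 1 (by decide)
    change cp (M 0 0) .right ↔ cp (M 0 1) .left at h₁
    change cp (M 1 0) .right ↔ cp (M 1 1) .left at h₂
    change cp (M 0 0) .bottom ↔ cp (M 1 0) .top at h₃
    change cp (M 0 1) .bottom ↔ cp (M 1 1) .top at h₄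
    have e₁ := eq_blank_or_of_not_cp_top_left (M 0 0) ((hb 0 0).1 rfl) ((hb 0 0).2.2.1 rfl)
    have e₂ := eq_blank_or_of_not_cp_top_right (M 0 1) ((hb 0 1).1 rfl) ((hb 0 1).2.2.2 rfl)
    have e₃ := eq_blank_or_of_not_cp_bottom_left (M 1 0) ((hb 1 0).2.1 rfl) ((hb 1 0).2.2.1 rfl)
    have e₄ := eq_blank_or_of_not_cp_bottom_right (M 1 1) ((hb 1 1).2.1 rfl)
      ((hb 1 1).2.2.2 rfl)
    rcases e₁ with e₁ | e₁ <;> rcases e₂ with e₂ | e₂ <;> rcases e₃ with e₃ | e₃ <;>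
      rcases e₄ with e₄ | e₄ <;> rw [e₁, e₂] at h₁ <;> rw [e₃, e₄] at h₂ <;>
      rw [e₁, e₃] at h₃ <;> rw [e₂, e₄] at h₄ <;>
      first
        | exact absurd h₁ (by decide)
        | exact absurd h₂ (by decide)
        | exact absurd h₃ (by decide)
        | exact absurd h₄ (by decide)
        | (left; funext a b; fin_cases a <;> fin_cases b <;> assumption)
        | (right; funext a b; fin_cases a <;> fin_cases b <;> assumption)
  · rintro (rfl | rfl) <;> unfold IsKnotMosaic <;> decide

/-- There are exactly two knot `2`-mosaics: the all-blank mosaic and the mosaic with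
tiles `T₂, T₁` in the top row and `T₃, T₄` in the bottom row; hence the Hilbert space
of knot `2`-mosaics has dimension `D₂ = 2`. -/
theorem card_knot_two_mosaics :
    Nat.card {M : Mosaic 2 // IsKnotMosaic M} = 2 ∧
    {M : Mosaic 2 | IsKnotMosaic M} =
      {(fun _ _ => (0 : Fin 11)),
       (fun a b => if a = 0 then (if b = 0 then (2 : Fin 11) else 1)
                   else (if b = 0 then 3 else 4))} := by
  have hset : {M : Mosaic 2 | IsKnotMosaic M} =
      {(fun _ _ => (0 : Fin 11)),
       (fun a b => if a = 0 then (if b = 0 then (2 : Fin 11) else 1)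
                   else (if b = 0 then 3 else 4))} :=
    Set.ext isKnotMosaic_two_iff
  refine ⟨?_, hset⟩
  change Set.ncard {M : Mosaic 2 | IsKnotMosaic M} = 2
  rw [hset]
  refine Set.ncard_pair fun h => ?_
  exact absurd (congrFun (congrFun h 0) 0) (by decide)
end

section
/- There are exactly 22 knot 3-mosaics: the set of 3-mosaics that are knot 3-mosaics has cardinality 22. Hence the Hilbert space of knot 3-mosaics has dimension D₃ = 22. -/
instance inst_s14 (t : Fin 11) (e : MEdge) : Decidable (cp t e) :=
  match t with
  | ⟨0, _⟩ => inferInstanceAs (Decidable False)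
  | ⟨1, _⟩ => inferInstanceAs (Decidable (e = MEdge.left ∨ e = MEdge.bottom))
  | ⟨2, _⟩ => inferInstanceAs (Decidable (e = MEdge.right ∨ e = MEdge.bottom))
  | ⟨3, _⟩ => inferInstanceAs (Decidable (e = MEdge.top ∨ e = MEdge.right))
  | ⟨4, _⟩ => inferInstanceAs (Decidable (e = MEdge.top ∨ e = MEdge.left))
  | ⟨5, _⟩ => inferInstanceAs (Decidable (e = MEdge.left ∨ e = MEdge.right))
  | ⟨6, _⟩ => inferInstanceAs (Decidable (e = MEdge.top ∨ e = MEdge.bottom))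
  | ⟨_ + 7, _⟩ => inferInstanceAs (Decidable True)

instance {n : ℕ} : DecidablePred (IsKnotMosaic (n := n)) := by
  intro (M : Fin n → Fin n → Fin 11)
  unfold IsKnotMosaic
  infer_instance

/-- The tile whose only arc joins the given edges (top, bottom, left, right);
this is the empty tile `0` unless exactly two edges are given. -/
def arcTile : Bool → Bool → Bool → Bool → Fin 11
  | false, true, true, false => 1
  | false, true, false, true => 2
  | true, false, false, true => 3
  | true, false, true, false => 4
  | false, false, true, true => 5
  | true, true, false, false => 6
  | _, _, _, _ => 0

/-- The number of connection points of a tile is even. -/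
theorem cp_parity (t : Fin 11) :
    cp t .top ↔ (cp t .bottom ↔ (cp t .left ↔ cp t .right)) := by
  revert t; decide

theorem eq_arcTile {t : Fin 11} {e : MEdge} (h : ¬ cp t e) :
    t = arcTile (cp t .top) (cp t .bottom) (cp t .left) (cp t .right) := by
  revert t; cases e <;> decide

/-- The `3`-mosaic whose corners are nonempty or empty as prescribed by `a b c d` (in reading
order), whose centre is `t`, and whose remaining tiles are determined by the corners. -/
def mosaicOfCorners (x : (Bool × Bool × Bool × Bool) × Fin 11) : Mosaic 3 :=
  match x with
  | ((a, b, c, d), t) =>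
    ![![arcTile false a false a, arcTile false (a ^^ b) a b, arcTile false b b false],
      ![arcTile a c false (a ^^ c), t, arcTile b d (b ^^ d) false],
      ![arcTile c false false c, arcTile (c ^^ d) false c d, arcTile d false d false]]

/-- Which corners of a `3`-mosaic are joined to the neighbouring tile in their row, together with
the central tile. -/
def cornersOf (M : Mosaic 3) : (Bool × Bool × Bool × Bool) × Fin 11 :=
  ((decide (cp (M 0 0) .right), decide (cp (M 0 2) .left),
    decide (cp (M 2 0) .right), decide (cp (M 2 2) .left)), M 1 1)

theorem cornersOf_mosaicOfCorners (x : (Bool × Bool × Bool × Bool) × Fin 11) :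
    cornersOf (mosaicOfCorners x) = x := by
  obtain ⟨⟨a, b, c, d⟩, t⟩ := x
  cases a <;> cases b <;> cases c <;> cases d <;> rfl

theorem IsKnotMosaic.mosaicOfCorners_cornersOf {M : Mosaic 3} (hM : IsKnotMosaic M) :
    mosaicOfCorners (cornersOf M) = M := by
  obtain ⟨hr, hc, hb⟩ := hM
  have r00 := hr 0 0 (by decide)
  have r01 := hr 0 1 (by decide)
  have r20 := hr 2 0 (by decide)
  have r21 := hr 2 1 (by decide)
  have c00 := hc 0 0 (by decide)
  have c10 := hc 1 0 (by decide)
  have c02 := hc 0 2 (by decide)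
  have c12 := hc 1 2 (by decide)
  have top := fun j => (hb 0 j).1 rfl
  have bottom := fun j => (hb 2 j).2.1 rfl
  have left := fun i => (hb i 0).2.2.1 rfl
  have right := fun i => (hb i 2).2.2.2 rfl
  simp only [Fin.isValue, Fin.val_zero, Fin.val_one, zero_add, Nat.reduceAdd,
    Fin.mk_one, Fin.reduceFinMk] at r00 r01 r20 r21 c00 c10 c02 c12
  have p00 := cp_parity (M 0 0)
  have p01 := cp_parity (M 0 1)
  have p02 := cp_parity (M 0 2)
  have p10 := cp_parity (M 1 0)
  have p12 := cp_parity (M 1 2)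
  have p20 := cp_parity (M 2 0)
  have p21 := cp_parity (M 2 1)
  have p22 := cp_parity (M 2 2)
  funext i j
  fin_cases i <;> fin_cases j
  · refine Eq.trans ?_ (eq_arcTile (top 0)).symm
    simp only [mosaicOfCorners, cornersOf]
    change arcTile _ _ _ _ = _
    congr 1 <;> grind
  · refine Eq.trans ?_ (eq_arcTile (top 1)).symm
    simp only [mosaicOfCorners, cornersOf]
    change arcTile _ _ _ _ = _
    congr 1 <;> grind
  · refine Eq.trans ?_ (eq_arcTile (top 2)).symm
    simp only [mosaicOfCorners, cornersOf]
    change arcTile _ _ _ _ = _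
    congr 1 <;> grind
  · refine Eq.trans ?_ (eq_arcTile (left 1)).symm
    simp only [mosaicOfCorners, cornersOf]
    change arcTile _ _ _ _ = _
    congr 1 <;> grind
  · rfl
  · refine Eq.trans ?_ (eq_arcTile (right 1)).symm
    simp only [mosaicOfCorners, cornersOf]
    change arcTile _ _ _ _ = _
    congr 1 <;> grind
  · refine Eq.trans ?_ (eq_arcTile (bottom 0)).symm
    simp only [mosaicOfCorners, cornersOf]
    change arcTile _ _ _ _ = _
    congr 1 <;> grind
  · refine Eq.trans ?_ (eq_arcTile (bottom 1)).symm
    simp only [mosaicOfCorners, cornersOf]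
    change arcTile _ _ _ _ = _
    congr 1 <;> grind
  · refine Eq.trans ?_ (eq_arcTile (bottom 2)).symm
    simp only [mosaicOfCorners, cornersOf]
    change arcTile _ _ _ _ = _
    congr 1 <;> grind

/-- Knot `3`-mosaics are classified by their corners and centre. -/
def knotThreeMosaicEquiv :
    {M : Mosaic 3 // IsKnotMosaic M} ≃ {x // IsKnotMosaic (mosaicOfCorners x)} where
  toFun M := ⟨cornersOf M, by rw [M.2.mosaicOfCorners_cornersOf]; exact M.2⟩
  invFun x := ⟨mosaicOfCorners x, x.2⟩
  left_inv M := Subtype.ext M.2.mosaicOfCorners_cornersOf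
  right_inv x := Subtype.ext (cornersOf_mosaicOfCorners x)

/-- There are exactly `22` knot `3`-mosaics; hence the Hilbert space of knot
`3`-mosaics has dimension `D₃ = 22`. -/
theorem card_knot_three_mosaics :
    Nat.card {M : Mosaic 3 // IsKnotMosaic M} = 22 := by
  rw [Nat.card_congr knotThreeMosaicEquiv, Nat.card_eq_fintype_card, Fintype.card_subtype]
  decide +kernel
end
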